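/- arXiv:1011.5606 — 2 statements merged into one kernel-verified Lean document; each statement's English description precedes it below -/
import Mathlib

section
/- Suppose −λ < μ < 0. Then the Markov chain X admits no invariant probability measure (the chain is non-positive). -/
open MeasureTheory ProbabilityTheory Filter

noncomputable section

/-- One step of the dynamics, given current state `x = (R, Z)` and noise `n`:
`R' = R − λ·max(−R,0) + λ(λ+μ)Z + max(min(ζ, r* − R), −ξ) + n`,
`Z' = max(−R,0) + (1−λ−μ)Z`. -/
def step (lam mu zeta xi rstar : ℝ) (x : ℝ × ℝ) (n : ℝ) : ℝ × ℝ :=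
  (x.1 - lam * max (-x.1) 0 + lam * (lam + mu) * x.2
      + max (min zeta (rstar - x.1)) (-xi) + n,
   max (-x.1) 0 + (1 - lam - mu) * x.2)

/-- The Gaussian noise distribution `N(0, σ²)`. -/
def noise (sigma : ℝ) : Measure ℝ := gaussianReal 0 (sigma ^ 2).toNNReal

/-- The one-step transition kernel `P(x, ·)`: the law of `step x N` with `N ~ N(0, σ²)`. -/
def kerP (lam mu zeta xi rstar sigma : ℝ) (x : ℝ × ℝ) : Measure (ℝ × ℝ) :=
  (noise sigma).map (step lam mu zeta xi rstar x)

/-- The `n`-step transition kernel `Pⁿ(x, ·)`. -/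
def kerPn (lam mu zeta xi rstar sigma : ℝ) : ℕ → (ℝ × ℝ) → Measure (ℝ × ℝ)
  | 0, x => Measure.dirac x
  | n + 1, x => (kerP lam mu zeta xi rstar sigma x).bind (kerPn lam mu zeta xi rstar sigma n)

/-- Total variation distance between two measures: sup over Borel sets of the
absolute difference. -/
def tvDist (m1 m2 : Measure (ℝ × ℝ)) : ℝ :=
  ⨆ B : { B : Set (ℝ × ℝ) // MeasurableSet B }, |(m1 B).toReal - (m2 B).toReal|

end

theorem measurable_step (lam mu zeta xi rstar : ℝ) :
    Measurable fun p : (ℝ × ℝ) × ℝ => step lam mu zeta xi rstar p.1 p.2 := by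
  unfold step
  fun_prop

instance isProbabilityMeasure_noise (sigma : ℝ) : IsProbabilityMeasure (noise sigma) := by
  unfold noise
  infer_instance

theorem measurable_kerP (lam mu zeta xi rstar sigma : ℝ) :
    Measurable (kerP lam mu zeta xi rstar sigma) := by
  refine Measure.measurable_of_measurable_coe _ fun s hs => ?_
  have hstep := measurable_step lam mu zeta xi rstar
  have heq : (fun x => kerP lam mu zeta xi rstar sigma x s) = fun x => noise sigma
      (Prod.mk x ⁻¹' ((fun p : (ℝ × ℝ) × ℝ => step lam mu zeta xi rstar p.1 p.2) ⁻¹' s)) := by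
    funext x
    exact Measure.map_apply (hstep.comp measurable_prodMk_left) hs
  rw [heq]
  exact measurable_measure_prodMk_left (hstep hs)

/-- An invariant probability measure cannot charge a region where a bounded function strictly
decreases on average. -/
theorem bind_ne_self_of_lintegral_lt {α : Type*} [MeasurableSpace α] {π : Measure α}
    [IsProbabilityMeasure π] {κ : α → Measure α} (hκ : Measurable κ) {F : α → ENNReal}
    (hF : Measurable F) (hF1 : ∀ x, F x ≤ 1) (hlt : ∀ᵐ x ∂π, ∫⁻ y, F y ∂(κ x) < F x) :
    π.bind κ ≠ π := by
  intro h
  have hint : ∫⁻ x, ∫⁻ y, F y ∂(κ x) ∂π = ∫⁻ x, F x ∂π := by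
    rw [← Measure.lintegral_bind hκ.aemeasurable hF.aemeasurable, h]
  have hfin : ∫⁻ x, F x ∂π ≤ 1 := by
    simpa using lintegral_mono (μ := π) hF1
  have := lintegral_strict_mono (IsProbabilityMeasure.ne_zero π) hF.aemeasurable
    (hint ▸ (hfin.trans_lt ENNReal.one_lt_top).ne) hlt
  exact this.ne hint

theorem lintegral_div_max_noise_lt_one {sigma K : ℝ} (hsigma : 0 < sigma) (hK : 0 < K) (a : ℝ) :
    ∫⁻ n, ENNReal.ofReal (K / max (a - n) K) ∂(noise sigma) < 1 := by
  have hle : ∀ n : ℝ, ENNReal.ofReal (K / max (a - n) K) ≤ 1 := fun n => by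
    rw [ENNReal.ofReal_le_one]
    exact div_le_one_of_le₀ (le_max_right _ _) (hK.le.trans (le_max_right _ _))
  have hpos : noise sigma (Set.Iio (a - K)) ≠ 0 := by
    intro h0
    have hv : (sigma ^ 2).toNNReal ≠ 0 := (Real.toNNReal_pos.2 (by positivity)).ne'
    have := gaussianReal_absolutelyContinuous' 0 hv h0
    simp at this
  have hfin : ∫⁻ n, ENNReal.ofReal (K / max (a - n) K) ∂(noise sigma) ≠ ⊤ := by
    refine ne_top_of_le_ne_top ENNReal.one_ne_top ?_
    simpa using lintegral_mono (μ := noise sigma) hle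
  have := lintegral_strict_mono_of_ae_le_of_ae_lt_on (μ := noise sigma)
    (g := fun _ => 1) aemeasurable_const hfin (ae_of_all _ hle) hpos
    (ae_of_all _ fun n hn => by
      have hn' : K < a - n := by
        have : n < a - K := hn
        linarith
      rw [ENNReal.ofReal_lt_one, max_eq_left hn'.le]
      exact (div_lt_one (hK.trans hn')).2 hn')
  simpa using this

theorem noise_ge_le {sigma t : ℝ} (ht : 0 < t) :
    noise sigma {n | t ≤ n} ≤ ENNReal.ofReal (sigma ^ 2 / t ^ 2) := by
  have h := meas_ge_le_variance_div_sq (μ := noise sigma) (X := id)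
    (memLp_id_gaussianReal 2) ht
  have hvar : variance id (noise sigma) = sigma ^ 2 := by
    unfold noise
    rw [variance_id_gaussianReal, Real.coe_toNNReal _ (sq_nonneg _)]
  have hmean : ∫ n, id n ∂(noise sigma) = 0 := integral_id_gaussianReal
  rw [hvar, hmean] at h
  refine (measure_mono fun n hn => ?_).trans h
  simpa using le_trans hn (le_abs_self n)

theorem lintegral_div_max_noise_lt {sigma m zeta K w : ℝ} (hm : 0 < m)
    (hK : 0 < K) (hzeta : 4 * zeta ≤ m * K)
    (hvar : 16 * sigma ^ 2 * (2 + m) ≤ m ^ 3 * K ^ 2) (hw : K < w) :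
    ∫⁻ n, ENNReal.ofReal (K / max ((1 + m) * w - zeta - n) K) ∂(noise sigma)
      < ENNReal.ofReal (K / w) := by
  have hw0 : 0 < w := hK.trans hw
  have ht : 0 < m * w / 4 := by positivity
  have hpt : ∀ n : ℝ, ENNReal.ofReal (K / max ((1 + m) * w - zeta - n) K) ≤
      ENNReal.ofReal (K / ((1 + m / 2) * w))
        + Set.indicator {n | m * w / 4 ≤ n} (fun _ => 1) n := fun n => by
    by_cases hn : m * w / 4 ≤ n
    · rw [Set.indicator_of_mem (show n ∈ {n | m * w / 4 ≤ n} from hn)]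
      refine le_trans ?_ le_add_self
      rw [ENNReal.ofReal_le_one]
      exact div_le_one_of_le₀ (le_max_right _ _) (hK.le.trans (le_max_right _ _))
    · refine le_trans (ENNReal.ofReal_le_ofReal ?_) le_self_add
      push Not at hn
      have : m * K ≤ m * w := by gcongr
      exact div_le_div_of_nonneg_left hK.le (by positivity)
        (le_trans (by linarith) (le_max_left _ _))
  have hms : MeasurableSet {n : ℝ | m * w / 4 ≤ n} := measurableSet_Ici
  calc ∫⁻ n, ENNReal.ofReal (K / max ((1 + m) * w - zeta - n) K) ∂(noise sigma)
      ≤ ENNReal.ofReal (K / ((1 + m / 2) * w)) + noise sigma {n | m * w / 4 ≤ n} := by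
        refine (lintegral_mono hpt).trans_eq ?_
        rw [lintegral_add_left measurable_const, lintegral_indicator hms]
        simp
    _ ≤ ENNReal.ofReal (K / ((1 + m / 2) * w) + sigma ^ 2 / (m * w / 4) ^ 2) := by
        rw [ENNReal.ofReal_add (by positivity) (by positivity)]
        gcongr
        exact noise_ge_le ht
    _ < ENNReal.ofReal (K / w) := by
        rw [ENNReal.ofReal_lt_ofReal_iff (by positivity)]
        have hgap : K / w - (K / ((1 + m / 2) * w) + sigma ^ 2 / (m * w / 4) ^ 2)
            = (m ^ 3 * K * w - 16 * sigma ^ 2 * (2 + m)) / (m ^ 2 * w ^ 2 * (2 + m)) := by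
          field_simp
          ring
        have hKw : m ^ 3 * K ^ 2 < m ^ 3 * K * w := by
          rw [pow_two, ← mul_assoc]
          gcongr
        have : 0 < K / w - (K / ((1 + m / 2) * w) + sigma ^ 2 / (m * w / 4) ^ 2) := by
          rw [hgap]
          exact div_pos (by linarith) (by positivity)
        linarith

/-- For `R < 0` the functional `-(R + (λ+μ)Z)` is multiplied by `1 - μ` in each step, up to the
reinforcement `ζ` and the noise. -/
theorem step_functional_of_neg {lam mu zeta xi rstar : ℝ} (hzeta : 0 < zeta) (hxi : 0 < xi)
    (hrstar : zeta < rstar) {x : ℝ × ℝ} (hx : x.1 < 0) (n : ℝ) :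
    -((step lam mu zeta xi rstar x n).1 + (lam + mu) * (step lam mu zeta xi rstar x n).2)
      = (1 + -mu) * -(x.1 + (lam + mu) * x.2) - zeta - n := by
  simp only [step]
  rw [max_eq_left (by linarith : (0 : ℝ) ≤ -x.1),
    min_eq_left (by linarith : zeta ≤ rstar - x.1), max_eq_left (by linarith : -xi ≤ zeta)]
  ring

theorem exists_truncation_level {sigma m zeta : ℝ} (hm : 0 < m) (hzeta : 0 < zeta) :
    ∃ K : ℝ, 0 < K ∧ 4 * zeta ≤ m * K ∧ 16 * sigma ^ 2 * (2 + m) ≤ m ^ 3 * K ^ 2 := by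
  set b := 16 * sigma ^ 2 * (2 + m) / m ^ 3 with hb
  have hb0 : 0 ≤ b := by positivity
  have hz0 : 0 < 4 * zeta / m := by positivity
  refine ⟨1 + 4 * zeta / m + b, by positivity, ?_, ?_⟩
  · calc 4 * zeta = m * (4 * zeta / m) := by field_simp
      _ ≤ m * (1 + 4 * zeta / m + b) := by gcongr; linarith
  · have h : 16 * sigma ^ 2 * (2 + m) = m ^ 3 * b := by rw [hb]; field_simp
    rw [h]
    gcongr
    nlinarith

/-- Theorem 3.6. If `−λ < μ < 0`, the Markov chain admits no invariant
probability measure on `S = ℝ × [0,∞)`. -/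
theorem no_invariant_measure_of_negative_evaporation
    (lam mu zeta xi rstar sigma : ℝ)
    (hlam : 0 < lam) (hzeta : 0 < zeta) (hxi : 0 < xi) (hrstar : zeta < rstar)
    (hsigma : 0 < sigma) (hmu1 : -lam < mu) (hmu2 : mu < 0) :
    ¬ ∃ π : Measure (ℝ × ℝ), IsProbabilityMeasure π ∧ π {p | p.2 < 0} = 0 ∧
        π.bind (kerP lam mu zeta xi rstar sigma) = π := by
  rintro ⟨π, hπ, hneg, hinv⟩
  obtain ⟨K, hK, hKzeta, hKvar⟩ := exists_truncation_level (sigma := sigma) (neg_pos.2 hmu2) hzeta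
  let F : ℝ × ℝ → ENNReal := fun x =>
    ENNReal.ofReal (K / max (-(x.1 + (lam + mu) * x.2)) K)
  have hF : Measurable F := by fun_prop
  have hF1 : ∀ x, F x ≤ 1 := fun x => by
    simp only [F, ENNReal.ofReal_le_one]
    exact div_le_one_of_le₀ (le_max_right _ _) (hK.le.trans (le_max_right _ _))
  refine bind_ne_self_of_lintegral_lt (measurable_kerP lam mu zeta xi rstar sigma) hF hF1 ?_ hinv
  have hpos : ∀ᵐ x ∂π, ¬ x.2 < 0 := by simpa [ae_iff] using hneg
  filter_upwards [hpos] with x hx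
  have hmap : ∫⁻ y, F y ∂(kerP lam mu zeta xi rstar sigma x)
      = ∫⁻ n, F (step lam mu zeta xi rstar x n) ∂(noise sigma) :=
    lintegral_map hF ((measurable_step lam mu zeta xi rstar).comp measurable_prodMk_left)
  rw [hmap]
  by_cases hw : K < -(x.1 + (lam + mu) * x.2)
  · have hx1 : x.1 < 0 := by
      have : 0 ≤ (lam + mu) * x.2 := mul_nonneg (by linarith) (not_lt.1 hx)
      linarith
    simp only [F, step_functional_of_neg hzeta hxi hrstar hx1, max_eq_left hw.le]
    exact lintegral_div_max_noise_lt (neg_pos.2 hmu2) hK hKzeta hKvar hw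
  · have hFx : F x = 1 := by
      simp only [F, max_eq_right (not_lt.1 hw), div_self hK.ne', ENNReal.ofReal_one]
    obtain ⟨a, haffine⟩ : ∃ a, ∀ n, -((step lam mu zeta xi rstar x n).1
        + (lam + mu) * (step lam mu zeta xi rstar x n).2) = a - n :=
      ⟨-((step lam mu zeta xi rstar x 0).1 + (lam + mu) * (step lam mu zeta xi rstar x 0).2),
        fun n => by simp only [step]; ring⟩
    simp only [hFx, F, haffine]
    exact lintegral_div_max_noise_lt_one hsigma hK a
end

section
/- Suppose −λ < μ < 0, and define G : S → [0,∞) by G(r,z) = log((r + (λ+μ)z)/μ) if v(r,z) := (r + (λ+μ)z)/μ ≥ 1 and G(r,z) = 0 otherwise. For states x = (r,z) with v(x) ≥ 1 (which necessarily lie in D1, i.e. r < 0), the drift 𝒟G(x) = E_x[G(X(1))] − G(x) depends only on v = v(x), and it converges to log(1−μ) > 0 as v → ∞. Consequently there exists v₀ > 1 such that 𝒟G(x) > 0 for every x with v(x) > v₀. -/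
open MeasureTheory ProbabilityTheory Filter

noncomputable section

/-- The function `G(r,z) = log((r + (λ+μ)z)/μ)` when `v(r,z) = (r + (λ+μ)z)/μ ≥ 1`,
and `G(r,z) = 0` otherwise. -/
def funG (lam mu : ℝ) (p : ℝ × ℝ) : ℝ :=
  if 1 ≤ (p.1 + (lam + mu) * p.2) / mu then
    Real.log ((p.1 + (lam + mu) * p.2) / mu)
  else 0

end

noncomputable section
/-- The transformed coordinate `v(r,z) = (r + (λ+μ)z)/μ`. -/
def vCoord (lam mu : ℝ) (p : ℝ × ℝ) : ℝ := (p.1 + (lam + mu) * p.2) / mu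

/-- The one-step drift of `G`: `𝒟G(x) = E_x[G(X(1))] − G(x)`. -/
def driftG (lam mu zeta xi rstar sigma : ℝ) (x : ℝ × ℝ) : ℝ :=
  (∫ n, funG lam mu (step lam mu zeta xi rstar x n) ∂(noise sigma)) - funG lam mu x
end

/-- On states with negative first coordinate, `v` evolves autonomously:
`v' = (1 − μ) v + (N + ζ)/μ`. -/
lemma vCoord_step {lam mu zeta xi rstar : ℝ} (hzeta : 0 < zeta) (hxi : 0 < xi)
    (hrstar : zeta < rstar) (hmu : mu < 0) {x : ℝ × ℝ} (hx : x.1 < 0) (n : ℝ) :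
    vCoord lam mu (step lam mu zeta xi rstar x n) =
      (1 - mu) * vCoord lam mu x + (n + zeta) / mu := by
  have h1 : max (-x.1) 0 = -x.1 := max_eq_left (by linarith)
  have h2 : min zeta (rstar - x.1) = zeta := min_eq_left (by linarith)
  have h3 : max zeta (-xi) = zeta := max_eq_left (by linarith)
  have hmu0 : mu ≠ 0 := hmu.ne
  simp only [vCoord, step, h1, h2, h3]
  field_simp
  ring

lemma funG_eq_log_max (lam mu : ℝ) (p : ℝ × ℝ) :
    funG lam mu p = Real.log (max (vCoord lam mu p) 1) := by
  unfold funG vCoord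
  split_ifs with h
  · rw [max_eq_left h]
  · rw [max_eq_right (not_le.mp h).le, Real.log_one]

lemma log_max_one_sub_le (x y : ℝ) :
    Real.log (max x 1) - Real.log (max y 1) ≤ |x - y| := by
  have hX : (0 : ℝ) < max x 1 := lt_max_of_lt_right one_pos
  have hY1 : (1 : ℝ) ≤ max y 1 := le_max_right _ _
  have hY : (0 : ℝ) < max y 1 := one_pos.trans_le hY1
  rw [← Real.log_div hX.ne' hY.ne']
  have hXY : max x 1 - max y 1 ≤ |x - y| :=
    (le_abs_self _).trans (abs_max_sub_max_le_abs x y 1)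
  refine (Real.log_le_sub_one_of_pos (div_pos hX hY)).trans ?_
  rw [sub_le_iff_le_add, div_le_iff₀ hY]
  nlinarith [abs_nonneg (x - y)]

lemma abs_log_max_one_sub_le (x y : ℝ) :
    |Real.log (max x 1) - Real.log (max y 1)| ≤ |x - y| :=
  abs_sub_le_iff.mpr ⟨log_max_one_sub_le x y, abs_sub_comm x y ▸ log_max_one_sub_le y x⟩

lemma abs_log_max_one_affine_sub_le {a v : ℝ} (ha : 1 ≤ a) (hv : 1 ≤ v) (w : ℝ) :
    |Real.log (max (a * v + w) 1) - Real.log (max v 1)| ≤ |w| + Real.log a := by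
  have h1 := abs_log_max_one_sub_le (a * v + w) (a * v)
  have h2 : Real.log (max (a * v) 1) - Real.log (max v 1) = Real.log a := by
    rw [max_eq_left hv, max_eq_left (one_le_mul_of_one_le_of_one_le ha hv),
      Real.log_mul (by positivity) (by positivity)]
    ring
  rw [add_sub_cancel_left] at h1
  rw [abs_le] at h1 ⊢
  have := Real.log_nonneg ha
  constructor <;> linarith [h1.1, h1.2]

lemma tendsto_log_max_one_affine_sub {a : ℝ} (ha : 0 < a) (w : ℝ) :
    Tendsto (fun v : ℝ => Real.log (max (a * v + w) 1) - Real.log (max v 1))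
      atTop (nhds (Real.log a)) := by
  have h1 : Tendsto (fun v : ℝ => Real.log (a + w / v)) atTop (nhds (Real.log a)) := by
    have h : Tendsto (fun v : ℝ => a + w / v) atTop (nhds (a + 0)) :=
      tendsto_const_nhds.add (tendsto_const_nhds.div_atTop tendsto_id)
    rw [add_zero] at h
    exact h.log ha.ne'
  have h2 : Tendsto (fun v : ℝ => a * v + w) atTop atTop :=
    tendsto_atTop_add_const_right _ _ (tendsto_id.const_mul_atTop ha)
  refine h1.congr' ?_
  filter_upwards [eventually_ge_atTop 1, h2.eventually_ge_atTop 1] with v hv hav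
  have hv0 : v ≠ 0 := by positivity
  rw [max_eq_left hv, max_eq_left hav, ← Real.log_div (by linarith) hv0]
  congr 1
  field_simp

instance (sigma : ℝ) : IsProbabilityMeasure (noise sigma) := by
  unfold noise; infer_instance

lemma integrable_abs_add_div_noise (sigma c d : ℝ) :
    Integrable (fun n : ℝ => |(n + c) / d|) (noise sigma) := by
  have h : Integrable (fun n : ℝ => n) (noise sigma) :=
    (memLp_id_gaussianReal 1).integrable le_rfl
  exact ((h.add (integrable_const c)).div_const d).abs

lemma tendsto_integral_log_max_one_affine_sub {a : ℝ} (ha : 1 ≤ a) (sigma c d : ℝ) :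
    Tendsto (fun v : ℝ => (∫ n, Real.log (max (a * v + (n + c) / d) 1) ∂(noise sigma))
      - Real.log (max v 1)) atTop (nhds (Real.log a)) := by
  have hbound := (integrable_abs_add_div_noise sigma c d).add (integrable_const (Real.log a))
  have hmeas (v : ℝ) : AEStronglyMeasurable
      (fun n : ℝ => Real.log (max (a * v + (n + c) / d) 1) - Real.log (max v 1))
      (noise sigma) := by
    apply Measurable.aestronglyMeasurable
    fun_prop
  have hlim : Tendsto (fun v : ℝ => ∫ n, (Real.log (max (a * v + (n + c) / d) 1)
      - Real.log (max v 1)) ∂(noise sigma)) atTop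
      (nhds (∫ _, Real.log a ∂(noise sigma))) := by
    refine tendsto_integral_filter_of_dominated_convergence _
      (Eventually.of_forall hmeas) ?_ hbound ?_
    · filter_upwards [eventually_ge_atTop 1] with v hv
      exact Eventually.of_forall fun n => abs_log_max_one_affine_sub_le ha hv _
    · exact Eventually.of_forall fun n =>
        tendsto_log_max_one_affine_sub (one_pos.trans_le ha) _
  rw [integral_const, probReal_univ, one_smul] at hlim
  refine hlim.congr' ?_
  filter_upwards [eventually_ge_atTop 1] with v hv
  have hint : Integrable (fun n : ℝ => Real.log (max (a * v + (n + c) / d) 1)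
      - Real.log (max v 1)) (noise sigma) :=
    hbound.mono' (hmeas v)
      (Eventually.of_forall fun n => abs_log_max_one_affine_sub_le ha hv _)
  have hint' : Integrable (fun n : ℝ => Real.log (max (a * v + (n + c) / d) 1))
      (noise sigma) := by
    refine (hint.add (integrable_const (Real.log (max v 1)))).congr ?_
    exact Eventually.of_forall fun n => sub_add_cancel _ _
  rw [integral_sub hint' (integrable_const _), integral_const, probReal_univ, one_smul]

lemma fst_neg_of_one_le_vCoord {lam mu : ℝ} (hmu1 : -lam < mu) (hmu2 : mu < 0)
    {x : ℝ × ℝ} (hx : 0 ≤ x.2) (hv : 1 ≤ vCoord lam mu x) : x.1 < 0 := by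
  unfold vCoord at hv
  rw [le_div_iff_of_neg hmu2] at hv
  nlinarith [mul_nonneg (show 0 ≤ lam + mu by linarith) hx]

lemma driftG_eq {lam mu zeta xi rstar : ℝ} (sigma : ℝ) (hzeta : 0 < zeta) (hxi : 0 < xi)
    (hrstar : zeta < rstar) (hmu : mu < 0) {x : ℝ × ℝ} (hx : x.1 < 0) :
    driftG lam mu zeta xi rstar sigma x =
      (∫ n, Real.log (max ((1 - mu) * vCoord lam mu x + (n + zeta) / mu) 1) ∂(noise sigma))
        - Real.log (max (vCoord lam mu x) 1) := by
  simp only [driftG, funG_eq_log_max, vCoord_step hzeta hxi hrstar hmu hx]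

/-- For `−λ < μ < 0`: states with `v(x) ≥ 1` lie in `D1`; on such states
the drift `𝒟G` depends only on `v(x)`; it converges to `log(1−μ) > 0` as `v → ∞`;
consequently there is `v₀ > 1` with `𝒟G(x) > 0` whenever `v(x) > v₀`. -/
theorem drift_of_G_positive
    (lam mu zeta xi rstar sigma : ℝ)
    (hlam : 0 < lam) (hzeta : 0 < zeta) (hxi : 0 < xi) (hrstar : zeta < rstar)
    (hsigma : 0 < sigma) (hmu1 : -lam < mu) (hmu2 : mu < 0) :
    (∀ x : ℝ × ℝ, 0 ≤ x.2 → 1 ≤ vCoord lam mu x → x.1 < 0) ∧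
    (∀ x y : ℝ × ℝ, 0 ≤ x.2 → 0 ≤ y.2 → 1 ≤ vCoord lam mu x →
      vCoord lam mu x = vCoord lam mu y →
      driftG lam mu zeta xi rstar sigma x = driftG lam mu zeta xi rstar sigma y) ∧
    0 < Real.log (1 - mu) ∧
    Tendsto (fun v : ℝ => driftG lam mu zeta xi rstar sigma (mu * v, 0))
      atTop (nhds (Real.log (1 - mu))) ∧
    ∃ v0 : ℝ, 1 < v0 ∧
      ∀ x : ℝ × ℝ, 0 ≤ x.2 → v0 < vCoord lam mu x →
        0 < driftG lam mu zeta xi rstar sigma x := by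
  have hfst (x : ℝ × ℝ) (hx : 0 ≤ x.2) (hv : 1 ≤ vCoord lam mu x) : x.1 < 0 :=
    fst_neg_of_one_le_vCoord hmu1 hmu2 hx hv
  have hdep (x y : ℝ × ℝ) (hx : 0 ≤ x.2) (hy : 0 ≤ y.2) (hv : 1 ≤ vCoord lam mu x)
      (hxy : vCoord lam mu x = vCoord lam mu y) :
      driftG lam mu zeta xi rstar sigma x = driftG lam mu zeta xi rstar sigma y := by
    rw [driftG_eq sigma hzeta hxi hrstar hmu2 (hfst x hx hv),
      driftG_eq sigma hzeta hxi hrstar hmu2 (hfst y hy (hxy ▸ hv)), hxy]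
  have hpos : 0 < Real.log (1 - mu) := Real.log_pos (by linarith)
  have hvc (v : ℝ) : vCoord lam mu (mu * v, 0) = v := by
    simp [vCoord, hmu2.ne]
  have hlim : Tendsto (fun v : ℝ => driftG lam mu zeta xi rstar sigma (mu * v, 0))
      atTop (nhds (Real.log (1 - mu))) := by
    refine (tendsto_integral_log_max_one_affine_sub (by linarith) sigma zeta mu).congr' ?_
    filter_upwards [eventually_gt_atTop 0] with v hv
    rw [driftG_eq sigma hzeta hxi hrstar hmu2 (mul_neg_of_neg_of_pos hmu2 hv), hvc]
  refine ⟨hfst, hdep, hpos, hlim, ?_⟩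
  obtain ⟨b, hb⟩ := eventually_atTop.mp (hlim.eventually (lt_mem_nhds hpos))
  refine ⟨max b 2, one_lt_two.trans_le (le_max_right _ _), fun x hx hv => ?_⟩
  have hv1 : 1 ≤ vCoord lam mu x := by linarith [le_max_right b 2]
  rw [hdep x (mu * vCoord lam mu x, 0) hx le_rfl hv1 (hvc _).symm]
  exact hb _ ((le_max_left b 2).trans hv.le)
end
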